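/- The union of the closed unit ball in ℂⁿ and a disjoint closed ball with center a ∈ e^{iθ}ℝⁿ (θ ∈ [0, π/2]) and radius r ≤ 1 is polynomially convex. -/

import Mathlib

open Complex Metric

/-- The polynomially convex hull of a compact set in ℂⁿ. -/
def polyHull {n : ℕ} (K : Set (EuclideanSpace ℂ (Fin n))) : Set (EuclideanSpace ℂ (Fin n)) :=
  {z | ∀ P : MvPolynomial (Fin n) ℂ,
    ‖MvPolynomial.eval (fun j => z j) P‖ ≤
      sSup ((fun w : EuclideanSpace ℂ (Fin n) => ‖MvPolynomial.eval (fun j => w j) P‖) '' K)}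

theorem exists_norm_one_sub_le_mul {S : Set ℂ} (hS : IsCompact S) (hne : S.Nonempty)
    (h0 : ∀ w ∈ S, w.re ≠ 0) :
    ∃ c : ℝ, 0 ≤ c ∧ c < 1 ∧ ∀ w ∈ S, (0 < w.re → ‖1 - w‖ ≤ c * ‖1 + w‖) ∧
      (w.re < 0 → ‖1 + w‖ ≤ c * ‖1 - w‖) := by
  have hsq (w : ℂ) : ‖1 + w‖ ^ 2 - ‖1 - w‖ ^ 2 = 4 * w.re := by
    rw [Complex.sq_norm, Complex.sq_norm, Complex.normSq_apply, Complex.normSq_apply]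
    simp
    ring
  have hlt (w : ℂ) (hw : 0 < w.re) : ‖1 - w‖ < ‖1 + w‖ :=
    lt_of_pow_lt_pow_left₀ 2 (norm_nonneg _) (by linarith [hsq w])
  have hgt (w : ℂ) (hw : w.re < 0) : ‖1 + w‖ < ‖1 - w‖ :=
    lt_of_pow_lt_pow_left₀ 2 (norm_nonneg _) (by linarith [hsq w])
  have hpos : ∀ w ∈ S, 0 < max ‖1 - w‖ ‖1 + w‖ := fun w hw => by
    rcases (h0 w hw).lt_or_gt with h | h
    · exact lt_max_of_lt_left ((norm_nonneg _).trans_lt (hgt w h))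
    · exact lt_max_of_lt_right ((norm_nonneg _).trans_lt (hlt w h))
  have hcont : ContinuousOn (fun w : ℂ => min ‖1 - w‖ ‖1 + w‖ / max ‖1 - w‖ ‖1 + w‖) S :=
    ContinuousOn.div (by fun_prop) (by fun_prop) fun w hw => (hpos w hw).ne'
  obtain ⟨v, hv, hmax⟩ := hS.exists_isMaxOn hne hcont
  refine ⟨min ‖1 - v‖ ‖1 + v‖ / max ‖1 - v‖ ‖1 + v‖, by positivity, ?_, fun w hw => ?_⟩
  · rw [div_lt_one (hpos v hv)]
    rcases (h0 v hv).lt_or_gt with h | h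
    · exact (min_le_right _ _).trans_lt ((hgt v h).trans_le (le_max_left _ _))
    · exact (min_le_left _ _).trans_lt ((hlt v h).trans_le (le_max_right _ _))
  · have h := (div_le_iff₀ (hpos w hw)).1 (isMaxOn_iff.1 hmax w hw)
    constructor
    · intro hr
      rwa [min_eq_left (hlt w hr).le, max_eq_right (hlt w hr).le] at h
    · intro hr
      rwa [min_eq_right (hgt w hr).le, max_eq_left (hgt w hr).le] at h

theorem norm_le_two_mul_of_mul_add_eq {a b g : ℂ} {η : ℝ} (hη : η ≤ 1 / 2) (hb : b ≠ 0)
    (hab : ‖a‖ ≤ η * ‖b‖) (hg : g * (b + a) = a) : ‖g‖ ≤ 2 * η := by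
  have hb' : 0 < ‖b‖ := norm_pos_iff.2 hb
  have h1 : ‖b‖ - ‖a‖ ≤ ‖b + a‖ := by simpa using norm_sub_norm_le b (-a)
  have h2 : ‖g‖ * ‖b + a‖ = ‖a‖ := by rw [← norm_mul, hg]
  have h3 : ‖b‖ / 2 ≤ ‖b + a‖ := by nlinarith
  have h4 := mul_le_mul_of_nonneg_left h3 (norm_nonneg g)
  exact le_of_mul_le_mul_right (by linarith) hb'

/-- In the closed algebra generated by the coordinate on a compact set missing the imaginary axis,
the coordinate minus any purely imaginary scalar is invertible. -/
theorem notMem_spectrum_elemental_of_re_eq_zero {S : Set ℂ} [CompactSpace S]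
    (h0 : ∀ w ∈ S, w.re ≠ 0) (f : C(S, ℂ)) (hf : ∀ w, f w = w) {l : ℂ} (hl : l.re = 0) :
    l ∉ spectrum ℂ (⟨f, Algebra.elemental.self_mem ℂ f⟩ : Algebra.elemental ℂ f) := by
  intro hmem
  have : IsClosed (Algebra.elemental ℂ f : Set C(S, ℂ)) := Algebra.elemental.isClosed ℂ f
  have hb := Subalgebra.spectrum_isBounded_connectedComponentIn (Algebra.elemental ℂ f) _ hmem
  have hspec : spectrum ℂ f = S := by
    rw [ContinuousMap.spectrum_eq_range]
    ext w
    simp [hf]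
  have hconn : IsPreconnected {w : ℂ | w.re = 0} := by
    have : Convex ℝ {w : ℂ | w.re = 0} := convex_hyperplane Complex.reLm.isLinear 0
    exact this.isPreconnected
  have hsub : {w : ℂ | w.re = 0} ⊆ connectedComponentIn (spectrum ℂ f)ᶜ l := by
    refine hconn.subset_connectedComponentIn hl fun w hw hwS => ?_
    rw [hspec] at hwS
    exact h0 w hwS hw
  obtain ⟨R, hR⟩ := (hb.subset hsub).exists_norm_le
  have := hR (((|R| + 1 : ℝ) : ℂ) * Complex.I) (by simp)
  rw [norm_mul, Complex.norm_I, Complex.norm_real, mul_one, Real.norm_eq_abs,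
    abs_of_pos (by positivity)] at this
  linarith [le_abs_self R]

open Polynomial in
theorem exists_polynomial_near_indicator_re_pos {S : Set ℂ} (hS : IsCompact S)
    (h0 : ∀ w ∈ S, w.re ≠ 0) {ε : ℝ} (hε : 0 < ε) :
    ∃ q : ℂ[X], (∀ w ∈ S, 0 < w.re → ‖q.eval w - 1‖ ≤ ε) ∧
      (∀ w ∈ S, w.re < 0 → ‖q.eval w‖ ≤ ε) := by
  rcases S.eq_empty_or_nonempty with rfl | hne
  · exact ⟨0, by simp, by simp⟩
  obtain ⟨c, hc0, hc1, hc⟩ := exists_norm_one_sub_le_mul hS hne h0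
  obtain ⟨N, hN⟩ := exists_pow_lt_of_lt_one (show 0 < min (1 / 2) (ε / 4) by positivity) hc1
  have hN1 : c ^ N ≤ 1 / 2 := (hN.trans_le (min_le_left _ _)).le
  have hN2 : c ^ N ≤ ε / 4 := (hN.trans_le (min_le_right _ _)).le
  have hN0 : N ≠ 0 := by
    rintro rfl
    norm_num at hN1
  have : CompactSpace S := isCompact_iff_compactSpace.1 hS
  let f : C(S, ℂ) := ⟨fun w => w, by fun_prop⟩
  let F : Algebra.elemental ℂ f := ⟨f, Algebra.elemental.self_mem ℂ f⟩
  have hF (l : ℂ) (hl : l.re = 0) : l ∉ spectrum ℂ F :=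
    notMem_spectrum_elemental_of_re_eq_zero h0 f (fun _ => rfl) hl
  have hunit : IsUnit (aeval F ((1 + X) ^ N + (1 - X) ^ N : ℂ[X])) := by
    rw [← spectrum.zero_notMem_iff ℂ, spectrum.map_polynomial_aeval_of_nonempty]
    · rintro ⟨l, hl, hl0⟩
      refine hF l ?_ hl
      have h1 : (1 + l) ^ N = -(1 - l) ^ N := by
        have : (1 + l) ^ N + (1 - l) ^ N = 0 := by simpa using hl0
        exact eq_neg_of_add_eq_zero_left this
      have h2 : ‖1 + l‖ ^ N = ‖1 - l‖ ^ N := by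
        rw [← norm_pow, h1, norm_neg, norm_pow]
      have h3 : ‖1 + l‖ = ‖1 - l‖ :=
        (pow_left_inj₀ (norm_nonneg _) (norm_nonneg _) hN0).1 h2
      have h4 : ‖1 + l‖ ^ 2 = ‖1 - l‖ ^ 2 := by rw [h3]
      rw [Complex.sq_norm, Complex.sq_norm, Complex.normSq_apply, Complex.normSq_apply] at h4
      simp at h4
      linarith
    · obtain ⟨w, hw⟩ := hne
      refine ⟨w, spectrum.subset_subalgebra F ?_⟩
      change w ∈ spectrum ℂ f
      rw [ContinuousMap.spectrum_eq_range]
      exact ⟨⟨w, hw⟩, rfl⟩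
  obtain ⟨u, hu⟩ := hunit.exists_right_inv
  let G : C(S, ℂ) := ((1 + F) ^ N * u : Algebra.elemental ℂ f)
  have hGmem : G ∈ Algebra.elemental ℂ f := Subtype.property _
  have hG (w : S) : G w * ((1 + w) ^ N + (1 - w) ^ N : ℂ) = (1 + w : ℂ) ^ N := by
    have h := congrArg (fun g : Algebra.elemental ℂ f => (g : C(S, ℂ)) w) hu
    have h' : ((1 + w) ^ N + (1 - w) ^ N : ℂ) * (u : C(S, ℂ)) w = 1 := by
      simpa [F, f] using h
    have hGw : G w = (1 + w : ℂ) ^ N * (u : C(S, ℂ)) w := by simp [G, F, f]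
    rw [hGw]
    linear_combination (1 + w : ℂ) ^ N * h'
  obtain ⟨g, hg, hgG⟩ : ∃ g ∈ Algebra.adjoin ℂ {f}, ‖G - g‖ < ε / 2 := by
    have : G ∈ closure (Algebra.adjoin ℂ {f} : Set C(S, ℂ)) := hGmem
    obtain ⟨g, hg, h⟩ := Metric.mem_closure_iff.1 this (ε / 2) (by positivity)
    exact ⟨g, hg, by rwa [dist_eq_norm] at h⟩
  rw [Algebra.adjoin_singleton_eq_range_aeval] at hg
  obtain ⟨q, rfl⟩ := hg
  have hq (w : S) : (aeval f q : C(S, ℂ)) w = q.eval (w : ℂ) := by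
    simp [Polynomial.aeval_continuousMap_apply, f]
  have hclose (w : S) : ‖G w - q.eval (w : ℂ)‖ ≤ ε / 2 := by
    rw [← hq]
    exact (ContinuousMap.norm_coe_le_norm _ w).trans hgG.le
  have hpow {a b : ℂ} (h : ‖a‖ ≤ c * ‖b‖) : ‖a ^ N‖ ≤ c ^ N * ‖b ^ N‖ := by
    rw [norm_pow, norm_pow, ← mul_pow]
    exact pow_le_pow_left₀ (norm_nonneg _) h N
  refine ⟨q, fun w hw hr => ?_, fun w hw hr => ?_⟩
  · have hb : (1 + w : ℂ) ^ N ≠ 0 := pow_ne_zero _ fun h => by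
      have := congrArg Complex.re h
      simp at this
      linarith
    have h1 : ‖1 - G ⟨w, hw⟩‖ ≤ 2 * c ^ N :=
      norm_le_two_mul_of_mul_add_eq hN1 hb (hpow ((hc w hw).1 hr))
        (by linear_combination -hG ⟨w, hw⟩)
    have h2 := hclose ⟨w, hw⟩
    calc ‖q.eval w - 1‖ = ‖(1 - G ⟨w, hw⟩) + (G ⟨w, hw⟩ - q.eval w)‖ := by
          rw [← norm_neg]; congr 1; ring
      _ ≤ _ := norm_add_le _ _
      _ ≤ ε := by dsimp only at h2; linarith
  · have hb : (1 - w : ℂ) ^ N ≠ 0 := pow_ne_zero _ fun h => by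
      have := congrArg Complex.re h
      simp at this
      linarith
    have h1 : ‖G ⟨w, hw⟩‖ ≤ 2 * c ^ N :=
      norm_le_two_mul_of_mul_add_eq hN1 hb (hpow ((hc w hw).2 hr))
        (by linear_combination hG ⟨w, hw⟩)
    have h2 := hclose ⟨w, hw⟩
    calc ‖q.eval w‖ = ‖G ⟨w, hw⟩ - (G ⟨w, hw⟩ - q.eval w)‖ := by
          congr 1; ring
      _ ≤ _ := norm_sub_le _ _
      _ ≤ ε := by dsimp only at h2; linarith

theorem continuous_eval_coord {n : ℕ} (P : MvPolynomial (Fin n) ℂ) :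
    Continuous fun w : EuclideanSpace ℂ (Fin n) => MvPolynomial.eval (fun j => w j) P :=
  (MvPolynomial.continuous_eval P).comp (by fun_prop)

theorem subset_polyHull {n : ℕ} {K : Set (EuclideanSpace ℂ (Fin n))} (hK : IsCompact K) :
    K ⊆ polyHull K := fun _ hz P =>
  le_csSup (hK.image (continuous_eval_coord P).norm).bddAbove (Set.mem_image_of_mem _ hz)

theorem norm_eval_le_of_mem_polyHull {n : ℕ} {K : Set (EuclideanSpace ℂ (Fin n))}
    (hne : K.Nonempty) {z : EuclideanSpace ℂ (Fin n)} (hz : z ∈ polyHull K)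
    (P : MvPolynomial (Fin n) ℂ) {C : ℝ}
    (hP : ∀ w ∈ K, ‖MvPolynomial.eval (fun j => w j) P‖ ≤ C) :
    ‖MvPolynomial.eval (fun j => z j) P‖ ≤ C :=
  (hz P).trans (csSup_le (hne.image _) (by rintro _ ⟨w, hw, rfl⟩; exact hP w hw))

/-- If the real part of a polynomial `p` separates `K₁` from `K₂ ∪ {z}` and `z` lies in the
polynomial hull of `K₁ ∪ K₂`, then polynomial bounds on `K₂` alone hold at `z`. -/
theorem norm_eval_le_of_mem_polyHull_union {n : ℕ} {K₁ K₂ : Set (EuclideanSpace ℂ (Fin n))}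
    (h₁ : IsCompact K₁) (h₂ : IsCompact K₂) (hne : (K₁ ∪ K₂).Nonempty)
    (p : MvPolynomial (Fin n) ℂ)
    (hp₁ : ∀ w ∈ K₁, (MvPolynomial.eval (fun j => w j) p).re < 0)
    (hp₂ : ∀ w ∈ K₂, 0 < (MvPolynomial.eval (fun j => w j) p).re)
    {z : EuclideanSpace ℂ (Fin n)} (hz : z ∈ polyHull (K₁ ∪ K₂))
    (hpz : 0 < (MvPolynomial.eval (fun j => z j) p).re)
    (Q : MvPolynomial (Fin n) ℂ) {C : ℝ} (hC : 0 ≤ C)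
    (hQ : ∀ w ∈ K₂, ‖MvPolynomial.eval (fun j => w j) Q‖ ≤ C) :
    ‖MvPolynomial.eval (fun j => z j) Q‖ ≤ C := by
  obtain ⟨B, hB⟩ := (h₁.image (continuous_eval_coord Q)).isBounded.exists_norm_le
  replace hB : ∀ w ∈ K₁, ‖MvPolynomial.eval (fun j => w j) Q‖ ≤ B :=
    fun w hw => hB _ (Set.mem_image_of_mem _ hw)
  let φ : EuclideanSpace ℂ (Fin n) → ℂ := fun w => MvPolynomial.eval (fun j => w j) p
  set A := ‖MvPolynomial.eval (fun j => z j) Q‖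
  have key (ε : ℝ) (hε : 0 < ε) : (1 - ε) * A ≤ max (ε * B) ((1 + ε) * C) := by
    obtain ⟨q, hq₂, hq₁⟩ := exists_polynomial_near_indicator_re_pos
      (S := φ '' insert z (K₁ ∪ K₂)) (((h₁.union h₂).insert z).image (continuous_eval_coord p))
      (by
        rintro _ ⟨w, rfl | hw | hw, rfl⟩
        · exact hpz.ne'
        · exact (hp₁ w hw).ne
        · exact (hp₂ w hw).ne') hε
    have heval (w : EuclideanSpace ℂ (Fin n)) :
        MvPolynomial.eval (fun j => w j) (Polynomial.aeval p q * Q) =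
          q.eval (φ w) * MvPolynomial.eval (fun j => w j) Q := by
      have h := Polynomial.aeval_algHom_apply
        (MvPolynomial.aeval (R := ℂ) (fun j => w j)) p q
      rw [MvPolynomial.aeval_eq_eval, Polynomial.coe_aeval_eq_eval] at h
      rw [map_mul]
      exact congrArg (· * _) h.symm
    have hz' := norm_eval_le_of_mem_polyHull hne hz (Polynomial.aeval p q * Q)
      (C := max (ε * B) ((1 + ε) * C)) ?_
    · rw [heval, norm_mul] at hz'
      have h1 := hq₂ (φ z) ⟨z, by simp, rfl⟩ hpz
      have h2 : 1 - ε ≤ ‖q.eval (φ z)‖ := by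
        have := norm_sub_norm_le 1 (q.eval (φ z))
        rw [norm_one, norm_sub_rev] at this
        linarith
      exact (mul_le_mul_of_nonneg_right h2 (norm_nonneg _)).trans hz'
    · rintro w (hw | hw)
      · rw [heval, norm_mul]
        refine le_max_of_le_left ?_
        exact mul_le_mul (hq₁ _ ⟨w, by simp [hw], rfl⟩ (hp₁ w hw)) (hB w hw) (norm_nonneg _) hε.le
      · rw [heval, norm_mul]
        refine le_max_of_le_right ?_
        refine mul_le_mul ?_ (hQ w hw) (norm_nonneg _) (by positivity)
        have h1 := hq₂ (φ w) ⟨w, by simp [hw], rfl⟩ (hp₂ w hw)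
        have := norm_sub_norm_le (q.eval (φ w)) 1
        rw [norm_one] at this
        linarith
  have h1 : Filter.Tendsto (fun ε : ℝ => (1 - ε) * A) (nhdsWithin 0 (Set.Ioi 0)) (nhds A) := by
    have : Continuous fun ε : ℝ => (1 - ε) * A := by fun_prop
    simpa using (this.tendsto 0).mono_left nhdsWithin_le_nhds
  have h2 : Filter.Tendsto (fun ε : ℝ => max (ε * B) ((1 + ε) * C))
      (nhdsWithin 0 (Set.Ioi 0)) (nhds C) := by
    have : Continuous fun ε : ℝ => max (ε * B) ((1 + ε) * C) := by fun_prop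
    simpa [hC] using (this.tendsto 0).mono_left nhdsWithin_le_nhds
  exact le_of_tendsto_of_tendsto h1 h2 (eventually_mem_nhdsWithin.mono key)

theorem exists_mvPolynomial_eval_eq_inner_sub {n : ℕ} (u : EuclideanSpace ℂ (Fin n)) (k : ℂ) :
    ∃ P : MvPolynomial (Fin n) ℂ, ∀ w : EuclideanSpace ℂ (Fin n),
      MvPolynomial.eval (fun j => w j) P = inner ℂ u w - k :=
  ⟨∑ j, MvPolynomial.C (star (u j)) * MvPolynomial.X j - MvPolynomial.C k, fun w => by
    simp [PiLp.inner_apply, mul_comm]⟩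

theorem union_two_balls_polyconvex (n : ℕ) (θ : ℝ) (hθ : θ ∈ Set.Icc 0 (Real.pi / 2))
    (b : EuclideanSpace ℝ (Fin n)) (r : ℝ) (hr0 : 0 ≤ r) (hr1 : r ≤ 1)
    (a : EuclideanSpace ℂ (Fin n))
    (ha : a = fun j => Complex.exp (θ * Complex.I) * (b j : ℂ))
    (hd : Disjoint (Metric.closedBall (0 : EuclideanSpace ℂ (Fin n)) 1)
      (Metric.closedBall a r)) :
    polyHull (Metric.closedBall (0 : EuclideanSpace ℂ (Fin n)) 1 ∪ Metric.closedBall a r)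
      = Metric.closedBall (0 : EuclideanSpace ℂ (Fin n)) 1 ∪ Metric.closedBall a r := by
  have hdist : 1 + r < ‖a‖ := by
    have := (disjoint_closedBall_closedBall_iff zero_le_one hr0).1 hd
    rwa [dist_zero_left] at this
  refine Set.Subset.antisymm (fun z hz => ?_)
    (subset_polyHull ((isCompact_closedBall _ _).union (isCompact_closedBall _ _)))
  have hgap : ‖a‖ < ‖a‖ ^ 2 - r * ‖a‖ := by nlinarith
  have h0 (w : EuclideanSpace ℂ (Fin n)) (hw : w ∈ closedBall 0 1) :
      (inner ℂ a w : ℂ).re ≤ ‖a‖ := by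
    rw [mem_closedBall_zero_iff] at hw
    calc (inner ℂ a w : ℂ).re ≤ ‖a‖ * ‖w‖ := (Complex.re_le_norm _).trans (norm_inner_le_norm _ _)
      _ ≤ ‖a‖ := mul_le_of_le_one_right (norm_nonneg _) hw
  have ha' (w : EuclideanSpace ℂ (Fin n)) (hw : w ∈ closedBall a r) :
      ‖a‖ ^ 2 - r * ‖a‖ ≤ (inner ℂ a w : ℂ).re := by
    rw [mem_closedBall_iff_norm'] at hw
    have h1 : (inner ℂ a (a - w) : ℂ).re ≤ ‖a‖ * ‖a - w‖ :=
      (Complex.re_le_norm _).trans (norm_inner_le_norm _ _)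
    have h2 : (inner ℂ a a : ℂ).re = ‖a‖ ^ 2 := inner_self_eq_norm_sq (𝕜 := ℂ) a
    rw [inner_sub_right, Complex.sub_re, h2] at h1
    linarith [mul_le_mul_of_nonneg_left hw (norm_nonneg a)]
  obtain ⟨s, ⟨hs1, hs2⟩, hsz⟩ : ∃ s ∈ Set.Ioo ‖a‖ (‖a‖ ^ 2 - r * ‖a‖),
      s ≠ (inner ℂ a z : ℂ).re :=
    (Set.Ioo_infinite hgap).exists_notMem_finite (Set.finite_singleton _)
  obtain ⟨p, hp⟩ := exists_mvPolynomial_eval_eq_inner_sub a s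
  rcases hsz.lt_or_gt with h | h
  · right
    obtain ⟨Q, hQ⟩ := exists_mvPolynomial_eval_eq_inner_sub (z - a) (inner ℂ (z - a) a)
    have key := norm_eval_le_of_mem_polyHull_union (isCompact_closedBall _ _)
      (isCompact_closedBall _ _) ⟨0, by simp⟩ p
      (fun w hw => by
        rw [hp, Complex.sub_re, Complex.ofReal_re]
        linarith [h0 w hw])
      (fun w hw => by
        rw [hp, Complex.sub_re, Complex.ofReal_re]
        linarith [ha' w hw])
      hz (by rw [hp, Complex.sub_re, Complex.ofReal_re]; linarith) Q
      (C := ‖z - a‖ * r) (by positivity)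
      (fun w hw => by
        rw [hQ, ← inner_sub_right]
        rw [mem_closedBall_iff_norm] at hw
        exact (norm_inner_le_norm _ _).trans (mul_le_mul_of_nonneg_left hw (norm_nonneg _)))
    rw [hQ, ← inner_sub_right, inner_self_eq_norm_sq_to_K, norm_pow, RCLike.norm_ofReal, abs_norm] at key
    rw [mem_closedBall_iff_norm]
    by_contra! hlt
    nlinarith
  · left
    obtain ⟨Q, hQ⟩ := exists_mvPolynomial_eval_eq_inner_sub z 0
    rw [Set.union_comm] at hz
    have key := norm_eval_le_of_mem_polyHull_union (isCompact_closedBall _ _)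
      (isCompact_closedBall _ _) ⟨0, by simp⟩ (-p)
      (fun w hw => by
        rw [map_neg, hp, Complex.neg_re, Complex.sub_re, Complex.ofReal_re]
        linarith [ha' w hw])
      (fun w hw => by
        rw [map_neg, hp, Complex.neg_re, Complex.sub_re, Complex.ofReal_re]
        linarith [h0 w hw])
      hz (by rw [map_neg, hp, Complex.neg_re, Complex.sub_re, Complex.ofReal_re]; linarith) Q
      (C := ‖z‖) (norm_nonneg _)
      (fun w hw => by
        rw [hQ, sub_zero]
        rw [mem_closedBall_zero_iff] at hw
        exact (norm_inner_le_norm _ _).trans (mul_le_of_le_one_right (norm_nonneg _) hw))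
    rw [hQ, sub_zero, inner_self_eq_norm_sq_to_K, norm_pow, RCLike.norm_ofReal, abs_norm] at key
    rw [mem_closedBall_zero_iff]
    by_contra! hlt
    nlinarith
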